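/- arXiv:2103.10536 — 2 statements merged into one kernel-verified Lean document; each statement's English description precedes it below -/
import Mathlib

section
/- Let A' be a finite set of n agents, each with a nonnegative monotone submodular valuation v_i on a finite ground set G, and let V_i be the multilinear extension of v_i. Let y, y* ∈ [0,1]^{A'×G} with V_i(y_i) > 0 for every i ∈ A'. If ∑_{i∈A'} V_i(y*_i)/V_i(y_i) > e·n, then ∑_{i∈A'} (1/V_i(y_i)) · ∑_{j∈G} y*_{ij} · ∂_j V_i(y_i) > (e−1)·n, where ∂_j V_i(x) denotes V_i(x with coordinate j set to 1) − V_i(x with coordinate j set to 0). -/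
open Finset

/-- A set function `v` on a finite ground set is submodular if
`v(S ∩ T) + v(S ∪ T) ≤ v(S) + v(T)` for all `S, T`. -/
def Submodular {G : Type*} [DecidableEq G] (v : Finset G → ℝ) : Prop :=
  ∀ S T : Finset G, v (S ∩ T) + v (S ∪ T) ≤ v S + v T

/-- The multilinear extension of a set function `v` on a finite ground set `G`. -/
noncomputable def multilinear {G : Type*} [Fintype G] [DecidableEq G]
    (v : Finset G → ℝ) (x : G → ℝ) : ℝ :=
  ∑ S : Finset G, v S * ((∏ j ∈ S, x j) * ∏ j ∈ Sᶜ, (1 - x j))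

namespace Submodular

variable {G : Type*} [DecidableEq G] {v : Finset G → ℝ}

theorem union_le_add_sum_marginals (hsub : Submodular v) (hmono : Monotone v) (R S : Finset G) :
    v (R ∪ S) ≤ v S + ∑ j ∈ R, (v (insert j S) - v (S.erase j)) := by
  induction R using Finset.induction_on with
  | empty => simp
  | insert a R ha ih =>
    rw [Finset.sum_insert ha]
    have h_sub := hsub (R ∪ S) (insert a S)
    have h_union : (R ∪ S) ∪ insert a S = insert a R ∪ S := by
      grind
    rw [h_union] at h_sub
    have h_inter : v S ≤ v ((R ∪ S) ∩ insert a S) :=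
      hmono (Finset.subset_inter Finset.subset_union_right (Finset.subset_insert a S))
    have h_erase : v (S.erase a) ≤ v S := hmono (Finset.erase_subset a S)
    linarith

end Submodular

section Multilinear

variable {G : Type*} [Fintype G] [DecidableEq G]

theorem multilinear_add (v w : Finset G → ℝ) (x : G → ℝ) :
    multilinear (fun S => v S + w S) x = multilinear v x + multilinear w x := by
  simp [multilinear, add_mul, Finset.sum_add_distrib]

theorem multilinear_const_mul (c : ℝ) (v : Finset G → ℝ) (x : G → ℝ) :
    multilinear (fun S => c * v S) x = c * multilinear v x := by
  simp [multilinear, Finset.mul_sum, mul_assoc]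

theorem multilinear_sub (v w : Finset G → ℝ) (x : G → ℝ) :
    multilinear (fun S => v S - w S) x = multilinear v x - multilinear w x := by
  simp [multilinear, sub_mul, Finset.sum_sub_distrib]

theorem multilinear_sum {ι : Type*} (s : Finset ι) (v : ι → Finset G → ℝ) (x : G → ℝ) :
    multilinear (fun S => ∑ i ∈ s, v i S) x = ∑ i ∈ s, multilinear (v i) x := by
  simp only [multilinear, Finset.sum_mul]
  exact Finset.sum_comm

theorem multilinear_const (c : ℝ) (x : G → ℝ) : multilinear (fun _ : Finset G => c) x = c := by
  have h := Fintype.prod_add x (fun j => 1 - x j)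
  simp only [add_sub_cancel, Finset.prod_const_one] at h
  simp only [multilinear]
  rw [← Finset.mul_sum, ← h, mul_one]

theorem multilinear_mono {v w : Finset G → ℝ} {x : G → ℝ} (hx : ∀ j, 0 ≤ x j ∧ x j ≤ 1)
    (h : ∀ S, v S ≤ w S) : multilinear v x ≤ multilinear w x :=
  Finset.sum_le_sum fun S _ => mul_le_mul_of_nonneg_right (h S) <|
    mul_nonneg (Finset.prod_nonneg fun j _ => (hx j).1)
      (Finset.prod_nonneg fun j _ => sub_nonneg.2 (hx j).2)

theorem multilinear_eq_sum_powerset_erase (v : Finset G → ℝ) (x : G → ℝ) (j : G) :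
    multilinear v x = ∑ S ∈ (univ.erase j).powerset,
      ((1 - x j) * v S + x j * v (insert j S)) *
        ((∏ k ∈ S, x k) * ∏ k ∈ (univ.erase j) \ S, (1 - x k)) := by
  have h_univ : (univ : Finset (Finset G)) = (insert j (univ.erase j)).powerset := by
    rw [Finset.insert_erase (Finset.mem_univ j), Finset.powerset_univ]
  rw [multilinear, h_univ, Finset.sum_powerset_insert (Finset.notMem_erase j univ),
    ← Finset.sum_add_distrib]
  refine Finset.sum_congr rfl fun S hS => ?_
  have hj : j ∉ S := fun h => Finset.notMem_erase j univ (Finset.mem_powerset.1 hS h)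
  have h_compl : Sᶜ = insert j ((univ.erase j) \ S) := by
    ext k; by_cases hk : k = j <;> simp [hk, hj]
  have h_compl_insert : (insert j S)ᶜ = (univ.erase j) \ S := by
    ext k; simp
  rw [h_compl_insert, h_compl, Finset.prod_insert hj, Finset.prod_insert (by simp)]
  ring

theorem multilinear_update (v : Finset G → ℝ) (x : G → ℝ) (j : G) (t : ℝ) :
    multilinear v (Function.update x j t) =
      multilinear (fun S => (1 - t) * v (S.erase j) + t * v (insert j S)) x := by
  rw [multilinear_eq_sum_powerset_erase v _ j, multilinear_eq_sum_powerset_erase _ x j]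
  refine Finset.sum_congr rfl fun S hS => ?_
  have hj : j ∉ S := fun h => Finset.notMem_erase j univ (Finset.mem_powerset.1 hS h)
  have h_in : ∏ k ∈ S, Function.update x j t k = ∏ k ∈ S, x k :=
    Finset.prod_congr rfl fun k hk =>
      Function.update_of_ne (ne_of_mem_of_not_mem hk hj) _ _
  have h_out : ∏ k ∈ (univ.erase j) \ S, (1 - Function.update x j t k) =
      ∏ k ∈ (univ.erase j) \ S, (1 - x k) :=
    Finset.prod_congr rfl fun k hk => by
      rw [Function.update_of_ne (Finset.ne_of_mem_erase (Finset.mem_sdiff.1 hk).1)]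
  rw [h_in, h_out, Function.update_self, Finset.erase_eq_of_notMem hj, Finset.erase_insert hj,
    Finset.insert_idem]
  ring

theorem multilinear_update_one_sub_update_zero (v : Finset G → ℝ) (x : G → ℝ) (j : G) :
    multilinear v (Function.update x j 1) - multilinear v (Function.update x j 0) =
      multilinear (fun S => v (insert j S) - v (S.erase j)) x := by
  simp [multilinear_update, multilinear_sub]

theorem multilinear_indicator_mem (x : G → ℝ) (j : G) :
    multilinear (fun S => if j ∈ S then 1 else 0) x = x j := by
  have h := multilinear_update (fun S => if j ∈ S then 1 else 0) x j (x j)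
  simpa [multilinear_const] using h

theorem multilinear_sum_mem (a : G → ℝ) (x : G → ℝ) :
    multilinear (fun S => ∑ j ∈ S, a j) x = ∑ j, x j * a j := by
  have h : (fun S : Finset G => ∑ j ∈ S, a j) =
      fun S => ∑ j, a j * (if j ∈ S then 1 else 0) := by
    ext S; simp
  rw [h, multilinear_sum]
  refine Finset.sum_congr rfl fun j _ => ?_
  rw [multilinear_const_mul, multilinear_indicator_mem, mul_comm]

theorem Submodular.multilinear_le_add_sum_derivative {v : Finset G → ℝ} (hsub : Submodular v)
    (hmono : Monotone v) {x z : G → ℝ} (hx : ∀ j, 0 ≤ x j ∧ x j ≤ 1)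
    (hz : ∀ j, 0 ≤ z j ∧ z j ≤ 1) :
    multilinear v z ≤ multilinear v x + ∑ j, z j *
      (multilinear v (Function.update x j 1) - multilinear v (Function.update x j 0)) := by
  simp only [multilinear_update_one_sub_update_zero]
  rw [← multilinear_sum_mem, ← multilinear_const (multilinear v x) z, ← multilinear_add]
  refine multilinear_mono hz fun R => ?_
  rw [← multilinear_sum, ← multilinear_add, ← multilinear_const (v R) x]
  exact multilinear_mono hx fun S =>
    (hmono Finset.subset_union_left).trans (hsub.union_le_add_sum_marginals hmono R S)

end Multilinear

/-- if `∑_i V_i(y*_i)/V_i(y_i) > e·n`, then the direction `y*` gives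
derivative `∑_i (1/V_i(y_i)) ∑_j y*_{ij} ∂_j V_i(y_i) > (e−1)·n`. -/
theorem continuousGreedy_derivative_bound {A G : Type*} [Fintype A] [Fintype G]
    [DecidableEq G] (v : A → Finset G → ℝ)
    (hnn : ∀ i S, 0 ≤ v i S) (hmono : ∀ i, Monotone (v i)) (hsub : ∀ i, Submodular (v i))
    (y ystar : A → G → ℝ)
    (hy : ∀ i j, 0 ≤ y i j ∧ y i j ≤ 1)
    (hystar : ∀ i j, 0 ≤ ystar i j ∧ ystar i j ≤ 1)
    (hpos : ∀ i, 0 < multilinear (v i) (y i))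
    (h : Real.exp 1 * Fintype.card A
        < ∑ i : A, multilinear (v i) (ystar i) / multilinear (v i) (y i)) :
    (Real.exp 1 - 1) * Fintype.card A <
      ∑ i : A, (1 / multilinear (v i) (y i)) *
        ∑ j : G, ystar i j * (multilinear (v i) (Function.update (y i) j 1)
          - multilinear (v i) (Function.update (y i) j 0)) := by
  have h_term : ∀ i, multilinear (v i) (ystar i) / multilinear (v i) (y i) ≤
      1 + (1 / multilinear (v i) (y i)) *
        ∑ j : G, ystar i j * (multilinear (v i) (Function.update (y i) j 1)
          - multilinear (v i) (Function.update (y i) j 0)) := fun i => by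
    rw [one_div_mul_eq_div, one_add_div (hpos i).ne']
    exact div_le_div_of_nonneg_right
      ((hsub i).multilinear_le_add_sum_derivative (hmono i) (hy i) (hystar i)) (hpos i).le
  have h_sum := h.trans_le (Finset.sum_le_sum fun i _ => h_term i)
  rw [Finset.sum_add_distrib, Finset.sum_const, Finset.card_univ, nsmul_one] at h_sum
  linarith
end

section
/- Let c > 0 and let v be a nonnegative monotone submodular valuation on a finite ground set G with v(∅) = 0 and multilinear extension V. Let G' ⊆ G, L ⊆ G', S ⊆ G' ∖ L, and y ∈ [0,1]^{G'} (extended by 0 on G ∖ G') with ∑_{j∈L} y_j ≤ c + 1; set y^{(s)} = y^{(L)} + 1_S. Let h be either an item of G ∖ G' or absent. Suppose that either (i) h is present and v({h}) ≥ V(y^{(s)})/(c+2), or (ii) v({j}) < V(y^{(s)})/(c+2) for every j ∈ G'. Then v(S ∪ {h}) ≥ V(y^{(s)} + 1_h)/(c+3), where {h} = ∅ and 1_h = 0 if h is absent. -/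
open Finset

/-- The indicator vector of a finite set `S`. -/
def indVec {G : Type*} [DecidableEq G] (S : Finset G) : G → ℝ :=
  fun j => if j ∈ S then 1 else 0

/-- `x^{(S)}`: the vector equal to `x` on coordinates in `S` and `0` elsewhere. -/
def restr {G : Type*} [DecidableEq G] (x : G → ℝ) (S : Finset G) : G → ℝ :=
  fun j => if j ∈ S then x j else 0

/-- The (at most singleton) finset associated to an optional item. -/
def optSet {G : Type*} : Option G → Finset G
  | none => ∅
  | some g => {g}

/-- The probability of `S` when each item `j` is drawn independently with probability `x j`. -/
noncomputable def inclusionWeight {G : Type*} [Fintype G] [DecidableEq G]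
    (x : G → ℝ) (S : Finset G) : ℝ :=
  (∏ j ∈ S, x j) * ∏ j ∈ Sᶜ, (1 - x j)

section

variable {G : Type*} [Fintype G] [DecidableEq G]

lemma inclusionWeight_eq_prod_ite (x : G → ℝ) (S : Finset G) :
    inclusionWeight x S = ∏ j, if j ∈ S then x j else 1 - x j := by
  rw [Finset.prod_ite, inclusionWeight]
  congr 2 <;> ext j <;> simp

lemma inclusionWeight_nonneg {x : G → ℝ} (hx : ∀ j, 0 ≤ x j ∧ x j ≤ 1) (S : Finset G) :
    0 ≤ inclusionWeight x S :=
  mul_nonneg (prod_nonneg fun j _ => (hx j).1)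
    (prod_nonneg fun j _ => sub_nonneg.2 (hx j).2)

lemma sum_inclusionWeight (x : G → ℝ) : ∑ S, inclusionWeight x S = 1 := by
  simpa [inclusionWeight, compl_eq_univ_sdiff] using
    (Finset.prod_add x (fun j => 1 - x j) univ).symm

lemma sum_inclusionWeight_mem (x : G → ℝ) (i : G) :
    ∑ S, (if i ∈ S then inclusionWeight x S else 0) = x i := by
  have key := Finset.prod_add x (fun j => if j = i then 0 else 1 - x j) univ
  have hprod : ∏ j, (x j + if j = i then 0 else 1 - x j) = x i := by
    rw [Finset.prod_eq_single i] <;> simp +contextual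
  rw [hprod, powerset_univ] at key
  rw [key]
  refine sum_congr rfl fun S _ => ?_
  rw [← compl_eq_univ_sdiff]
  split_ifs with hi
  · rw [inclusionWeight]
    congr 1
    refine prod_congr rfl fun j hj => ?_
    rw [if_neg]
    rintro rfl
    exact (mem_compl.1 hj) hi
  · have hzero : ∏ j ∈ Sᶜ, (if j = i then 0 else 1 - x j) = 0 :=
      prod_eq_zero (i := i) (mem_compl.2 hi) (by simp)
    rw [hzero, mul_zero]

lemma multilinear_eq_sum_inclusionWeight (v : Finset G → ℝ) (x : G → ℝ) :
    multilinear v x = ∑ S, v S * inclusionWeight x S := rfl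

lemma inclusionWeight_eq_zero_of_mem {x : G → ℝ} {S : Finset G} {j : G} (hj : j ∈ S)
    (hx : x j = 0) : inclusionWeight x S = 0 := by
  rw [inclusionWeight, prod_eq_zero hj hx, zero_mul]

lemma inclusionWeight_eq_zero_of_notMem {x : G → ℝ} {S : Finset G} {j : G} (hj : j ∉ S)
    (hx : x j = 1) : inclusionWeight x S = 0 := by
  rw [inclusionWeight, prod_eq_zero (mem_compl.2 hj) (by rw [hx, sub_self]), mul_zero]

lemma inclusionWeight_add_indVec_union {x : G → ℝ} {A T : Finset G}
    (hx : ∀ j ∈ A, x j = 0) (hT : Disjoint T A) :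
    inclusionWeight (x + indVec A) (T ∪ A) = inclusionWeight x T := by
  simp only [inclusionWeight_eq_prod_ite]
  refine prod_congr rfl fun j _ => ?_
  by_cases hjA : j ∈ A
  · have hjT : j ∉ T := fun hjT => Finset.disjoint_left.1 hT hjT hjA
    simp [indVec, hjA, hjT, hx j hjA]
  · simp [indVec, hjA]

/-- Raising coordinates from `0` to `1` on `A` amounts to adding `A` to the random set. -/
lemma multilinear_add_indVec (v : Finset G → ℝ) {x : G → ℝ} {A : Finset G}
    (hx : ∀ j ∈ A, x j = 0) :
    multilinear v (x + indVec A) = multilinear (fun T => v (T ∪ A)) x := by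
  simp only [multilinear_eq_sum_inclusionWeight]
  have hdisj : ∑ T, v (T ∪ A) * inclusionWeight x T
      = ∑ T with Disjoint T A, v (T ∪ A) * inclusionWeight x T := by
    refine (sum_filter_of_ne fun T _ hne => ?_).symm
    refine Finset.disjoint_left.2 fun j hjT hjA => hne ?_
    rw [inclusionWeight_eq_zero_of_mem hjT (hx j hjA), mul_zero]
  have hsup : ∑ T, v T * inclusionWeight (x + indVec A) T
      = ∑ T with A ⊆ T, v T * inclusionWeight (x + indVec A) T := by
    refine (sum_filter_of_ne fun T _ hne j hjA => ?_).symm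
    by_contra hjT
    exact hne (by
      rw [inclusionWeight_eq_zero_of_notMem hjT (by simp [indVec, hjA, hx j hjA]), mul_zero])
  rw [hdisj, hsup]
  symm
  refine sum_nbij' (· ∪ A) (· \ A) ?_ ?_ ?_ ?_ ?_
  · simp
  · simp [sdiff_disjoint]
  · intro T hT
    exact union_sdiff_cancel_right (mem_filter.1 hT).2
  · intro T hT
    exact sdiff_union_of_subset (mem_filter.1 hT).2
  · intro T hT
    rw [inclusionWeight_add_indVec_union hx (mem_filter.1 hT).2]

lemma multilinear_le_multilinear {v w : Finset G → ℝ} {x : G → ℝ}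
    (hx : ∀ j, 0 ≤ x j ∧ x j ≤ 1) (hvw : ∀ T, v T ≤ w T) :
    multilinear v x ≤ multilinear w x :=
  sum_le_sum fun T _ => mul_le_mul_of_nonneg_right (hvw T) (inclusionWeight_nonneg hx T)

lemma multilinear_nonneg {v : Finset G → ℝ} {x : G → ℝ}
    (hx : ∀ j, 0 ≤ x j ∧ x j ≤ 1) (hv : ∀ T, 0 ≤ v T) : 0 ≤ multilinear v x :=
  sum_nonneg fun T _ => mul_nonneg (hv T) (inclusionWeight_nonneg hx T)

lemma multilinear_add_const (v : Finset G → ℝ) (a : ℝ) (x : G → ℝ) :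
    multilinear (fun T => v T + a) x = multilinear v x + a := by
  simp only [multilinear_eq_sum_inclusionWeight, add_mul, sum_add_distrib, ← mul_sum,
    sum_inclusionWeight, mul_one]

lemma multilinear_sum_s17 (w : G → ℝ) (x : G → ℝ) :
    multilinear (fun T => ∑ j ∈ T, w j) x = ∑ j, x j * w j := by
  simp only [multilinear_eq_sum_inclusionWeight, sum_mul]
  calc ∑ T, ∑ j ∈ T, w j * inclusionWeight x T
      = ∑ T, ∑ j, w j * (if j ∈ T then inclusionWeight x T else 0) := by
        refine sum_congr rfl fun T _ => ?_
        simp [mul_ite, sum_ite_mem]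
    _ = ∑ j, x j * w j := by
        rw [sum_comm]
        refine sum_congr rfl fun j _ => ?_
        rw [← mul_sum, sum_inclusionWeight_mem, mul_comm]

end

lemma Submodular.union_le_add {G : Type*} [DecidableEq G] {v : Finset G → ℝ}
    (hsub : Submodular v) (hnn : ∀ S, 0 ≤ v S) (S T : Finset G) :
    v (S ∪ T) ≤ v S + v T := by
  linarith [hsub S T, hnn (S ∩ T)]

lemma Submodular.union_le_sum_add {G : Type*} [DecidableEq G] {v : Finset G → ℝ}
    (hsub : Submodular v) (hnn : ∀ S, 0 ≤ v S) (T A : Finset G) :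
    v (T ∪ A) ≤ ∑ j ∈ T, v {j} + v A := by
  induction T using Finset.induction_on with
  | empty => simp
  | insert a T ha ih =>
    rw [sum_insert ha, insert_union, insert_eq]
    linarith [hsub.union_le_add hnn {a} (T ∪ A)]

/-- An upper bound for the multilinear extension at `x + 1_A` by singleton values. -/
lemma Submodular.multilinear_add_indVec_le {G : Type*} [Fintype G] [DecidableEq G]
    {v : Finset G → ℝ} (hsub : Submodular v) (hnn : ∀ S, 0 ≤ v S) {x : G → ℝ}
    (hx01 : ∀ j, 0 ≤ x j ∧ x j ≤ 1) {A : Finset G} (hx : ∀ j ∈ A, x j = 0) :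
    multilinear v (x + indVec A) ≤ ∑ j, x j * v {j} + v A := by
  rw [multilinear_add_indVec v hx, ← multilinear_sum_s17, ← multilinear_add_const]
  exact multilinear_le_multilinear hx01 fun T => hsub.union_le_sum_add hnn T A

lemma indVec_union_of_disjoint {G : Type*} [DecidableEq G] {A B : Finset G}
    (hAB : Disjoint A B) : indVec (A ∪ B) = indVec A + indVec B := by
  ext j
  by_cases hA : j ∈ A
  · have hB : j ∉ B := Finset.disjoint_left.1 hAB hA
    simp [indVec, hA, hB]
  · simp [indVec, hA]

/-- discarding the large items. With `y^{(s)} = y^{(L)} + 1_S`, if either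
the matched item `h` is worth at least `V(y^{(s)})/(c+2)`, or every item of `G'` is worth
less than `V(y^{(s)})/(c+2)`, then `v(S ∪ {h}) ≥ V(y^{(s)} + 1_h)/(c+3)`. -/
theorem discard_large_items {G : Type*} [Fintype G] [DecidableEq G]
    (c : ℝ) (hc : 0 < c)
    (v : Finset G → ℝ) (hnn : ∀ S, 0 ≤ v S) (hmono : Monotone v) (hsub : Submodular v)
    (hempty : v ∅ = 0)
    (G' : Finset G) (L : Finset G) (hL : L ⊆ G')
    (S : Finset G) (hS : S ⊆ G' \ L)
    (y : G → ℝ) (hy01 : ∀ j, 0 ≤ y j ∧ y j ≤ 1) (hyG' : ∀ j ∉ G', y j = 0)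
    (hymass : ∑ j ∈ L, y j ≤ c + 1)
    (h : Option G) (hh : ∀ g : G, h = some g → g ∉ G')
    (hcases :
      (∃ g : G, h = some g ∧
        multilinear v (restr y L + indVec S) / (c + 2) ≤ v {g}) ∨
      (∀ j ∈ G', v {j} < multilinear v (restr y L + indVec S) / (c + 2))) :
    multilinear v (restr y L + indVec S + indVec (optSet h)) / (c + 3)
      ≤ v (S ∪ optSet h) := by
  have hopt : ∀ j ∈ optSet h, j ∉ G' := by
    cases h with
    | none => simp [optSet]
    | some g => simpa [optSet] using hh g rfl
  have hSL : ∀ j ∈ S, j ∉ L := fun j hj => (mem_sdiff.1 (hS hj)).2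
  have hSG : ∀ j ∈ S, j ∈ G' := fun j hj => (mem_sdiff.1 (hS hj)).1
  have hr01 : ∀ j, 0 ≤ restr y L j ∧ restr y L j ≤ 1 := by
    intro j
    unfold restr
    split_ifs
    exacts [hy01 j, ⟨le_rfl, zero_le_one⟩]
  have hx01 : ∀ j, 0 ≤ (restr y L + indVec S) j ∧ (restr y L + indVec S) j ≤ 1 := by
    intro j
    by_cases hj : j ∈ S
    · simp [restr, indVec, hj, hSL j hj]
    · simpa [indVec, hj] using hr01 j
  have hx0 : ∀ j ∈ optSet h, (restr y L + indVec S) j = 0 := by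
    intro j hj
    have hjL : j ∉ L := fun hjL => hopt j hj (hL hjL)
    have hjS : j ∉ S := fun hjS => hopt j hj (hSG j hjS)
    simp [restr, indVec, hjL, hjS]
  have hshift := multilinear_add_indVec v hx0
  have hWX : multilinear v (restr y L + indVec S)
      ≤ multilinear v (restr y L + indVec S + indVec (optSet h)) := by
    rw [hshift]
    exact multilinear_le_multilinear hx01 fun T => hmono subset_union_left
  have hW0 := multilinear_nonneg hx01 hnn
  rw [div_le_iff₀ (by linarith)]
  rcases hcases with ⟨g, rfl, hg⟩ | hsmall
  · have hXle : multilinear v (restr y L + indVec S + indVec (optSet (some g)))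
        ≤ multilinear v (restr y L + indVec S) + v {g} := by
      rw [hshift, ← multilinear_add_const]
      exact multilinear_le_multilinear hx01 fun T => hsub.union_le_add hnn T {g}
    rw [div_le_iff₀ (by linarith)] at hg
    have hgS : v {g} ≤ v (S ∪ optSet (some g)) := hmono subset_union_right
    nlinarith
  · have hdisj : Disjoint S (optSet h) :=
      Finset.disjoint_left.2 fun j hjS hj => hopt j hj (hSG j hjS)
    have hr0 : ∀ j ∈ S ∪ optSet h, restr y L j = 0 := by
      intro j hj
      refine if_neg fun hjL => ?_
      rcases mem_union.1 hj with hj | hj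
      exacts [hSL j hj hjL, hopt j hj (hL hjL)]
    have hX := hsub.multilinear_add_indVec_le hnn hr01 hr0
    rw [indVec_union_of_disjoint hdisj, ← add_assoc] at hX
    set X := multilinear v (restr y L + indVec S + indVec (optSet h))
    set W := multilinear v (restr y L + indVec S)
    have hsum : ∑ j, restr y L j * v {j} ≤ (c + 1) * (W / (c + 2)) := by
      calc ∑ j, restr y L j * v {j} = ∑ j ∈ L, y j * v {j} := by
            simp [restr, ite_mul, sum_ite_mem]
        _ ≤ ∑ j ∈ L, y j * (W / (c + 2)) :=
            sum_le_sum fun j hj =>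
              mul_le_mul_of_nonneg_left (hsmall j (hL hj)).le (hy01 j).1
        _ = (∑ j ∈ L, y j) * (W / (c + 2)) := (sum_mul ..).symm
        _ ≤ (c + 1) * (W / (c + 2)) :=
            mul_le_mul_of_nonneg_right hymass (div_nonneg hW0 (by linarith))
    have hW : W / (c + 2) * (c + 2) = W := div_mul_cancel₀ _ (by linarith)
    have hWle : W / (c + 2) ≤ v (S ∪ optSet h) := by linarith
    linarith [mul_le_mul_of_nonneg_right hWle (by linarith : 0 ≤ c + 1),
      hnn (S ∪ optSet h)]
end
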